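/- For the n-prism G = C_n □ P_2, if n = 6k+1 or n = 6k+2 then the minimum of |q − 3| over all signless Laplacian eigenvalues q of G equals 2cos(2π⌊n/6⌋/n) − 1, and if n = 6k+4 or n = 6k+5 it equals 1 − 2cos(2π⌈n/6⌉/n). -/

import Mathlib

open Finset Matrix BigOperators

/-- The signless Laplacian matrix `Q(G) = D(G) + A(G)` of a simple graph, over `ℝ`. -/
noncomputable def signlessLaplacian {V : Type*} [Fintype V] [DecidableEq V]
    (G : SimpleGraph V) [DecidableRel G.Adj] : Matrix V V ℝ :=
  Matrix.diagonal (fun v => (G.degree v : ℝ)) + G.adjMatrix ℝ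

lemma signlessLaplacian_isHermitian {V : Type*} [Fintype V] [DecidableEq V]
    (G : SimpleGraph V) [DecidableRel G.Adj] : (signlessLaplacian G).IsHermitian := by
  unfold signlessLaplacian
  apply Matrix.IsHermitian.add
  · exact Matrix.isHermitian_diagonal _
  · rw [Matrix.IsHermitian, conjTranspose_eq_transpose_of_trivial]
    exact G.isSymm_adjMatrix

/-- The signless Laplacian eigenvalues of `G` (as a function on the vertex index type). -/
noncomputable def qEig {V : Type*} [Fintype V] [DecidableEq V]
    (G : SimpleGraph V) [DecidableRel G.Adj] : V → ℝ :=
  (signlessLaplacian_isHermitian G).eigenvalues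

lemma mem_range_qEig_iff {V : Type*} [Fintype V] [DecidableEq V]
    (G : SimpleGraph V) [DecidableRel G.Adj] (μ : ℝ) :
    μ ∈ Set.range (qEig G) ↔ ∃ v : V → ℝ, v ≠ 0 ∧ signlessLaplacian G *ᵥ v = μ • v := by
  unfold qEig
  rw [← Matrix.IsHermitian.spectrum_real_eq_range_eigenvalues, ← Matrix.spectrum_toLin',
    ← Module.End.hasEigenvalue_iff_mem_spectrum]
  constructor
  · intro h
    obtain ⟨v, hv⟩ := h.exists_hasEigenvector
    exact ⟨v, hv.2, by simpa using hv.apply_eq_smul⟩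
  · rintro ⟨v, hv, h⟩
    exact Module.End.hasEigenvalue_of_hasEigenvector
      (x := v) ⟨Module.End.mem_eigenspace_iff.2 (by simpa using h), hv⟩

lemma prism_neighborFinset (m : ℕ) (i : Fin (m + 3)) (s : Fin 2)
    [DecidableEq (Fin (m + 3) × Fin 2)]
    [DecidableRel ((SimpleGraph.cycleGraph (m + 3)).boxProd (SimpleGraph.pathGraph 2)).Adj] :
    ((SimpleGraph.cycleGraph (m + 3)).boxProd (SimpleGraph.pathGraph 2)).neighborFinset (i, s) =
      {(i + 1, s), (i - 1, s), (i, s + 1)} := by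
  ext ⟨j, t⟩
  have hst : s ≠ t ↔ t = s + 1 := by revert s t; decide
  simp only [SimpleGraph.mem_neighborFinset, SimpleGraph.boxProd_adj,
    SimpleGraph.cycleGraph_adj, SimpleGraph.pathGraph_two_eq_top, SimpleGraph.top_adj,
    Finset.mem_insert, Finset.mem_singleton, Prod.mk.injEq, hst]
  have h1 : i - j = 1 ↔ j = i - 1 :=
    ⟨fun h => by rw [← h]; abel, fun h => by rw [h]; abel⟩
  have h2 : j - i = 1 ↔ j = i + 1 :=
    ⟨fun h => by rw [← h]; abel, fun h => by rw [h]; abel⟩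
  rw [h1, h2, @eq_comm _ s t, @eq_comm _ i j]
  tauto

lemma prism_signlessLaplacian_mulVec (m : ℕ)
    [DecidableEq (Fin (m + 3) × Fin 2)]
    [DecidableRel ((SimpleGraph.cycleGraph (m + 3)).boxProd (SimpleGraph.pathGraph 2)).Adj]
    (v : Fin (m + 3) × Fin 2 → ℝ) (i : Fin (m + 3)) (s : Fin 2) :
    (signlessLaplacian
      ((SimpleGraph.cycleGraph (m + 3)).boxProd (SimpleGraph.pathGraph 2)) *ᵥ v) (i, s) =
      3 * v (i, s) + (v (i + 1, s) + v (i - 1, s) + v (i, s + 1)) := by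
  have hs : s ≠ s + 1 := by revert s; decide
  have h2 : (i + 1, s) ≠ (i, s + 1) := fun h => hs (Prod.ext_iff.1 h).2
  have h3 : (i - 1, s) ≠ (i, s + 1) := fun h => hs (Prod.ext_iff.1 h).2
  have h1 : (i + 1, s) ≠ (i - 1, s) := by
    intro h
    have h : i + 1 = i - 1 := (Prod.ext_iff.1 h).1
    have h' : (1 : Fin (m + 3)) + 1 = 0 := by
      calc (1 : Fin (m + 3)) + 1 = (i + 1) - (i - 1) := by abel
        _ = 0 := by rw [h]; abel
    have := congrArg Fin.val h'
    have h2 : (1 : Fin (m + 3)).val + (1 : Fin (m + 3)).val < m + 3 := by simp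
    simp [Fin.val_add, Nat.mod_eq_of_lt] at this
  have hsum : ∀ f : Fin (m + 3) × Fin 2 → ℝ, ∑ y ∈ ((SimpleGraph.cycleGraph (m + 3)).boxProd
      (SimpleGraph.pathGraph 2)).neighborFinset (i, s), f y =
        f (i + 1, s) + f (i - 1, s) + f (i, s + 1) := by
    intro f
    have hmem : (i + 1, s) ∉ ({(i - 1, s), (i, s + 1)} : Finset (Fin (m + 3) × Fin 2)) := by
      simp only [Finset.mem_insert, Finset.mem_singleton, not_or]
      exact ⟨h1, h2⟩
    rw [prism_neighborFinset, Finset.sum_insert hmem, Finset.sum_pair h3, add_assoc]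
  have hd : (((SimpleGraph.cycleGraph (m + 3)).boxProd
      (SimpleGraph.pathGraph 2)).degree (i, s) : ℝ) = 3 := by
    rw [← SimpleGraph.card_neighborFinset_eq_degree, Finset.cast_card, hsum]
    norm_num
  rw [signlessLaplacian, Matrix.add_mulVec, Pi.add_apply, Matrix.mulVec_diagonal,
    SimpleGraph.adjMatrix_mulVec_apply, hsum, hd]

open ZMod in
lemma exists_stdAddChar_of_cycle_eigenvector {n : ℕ} [NeZero n] {w : ZMod n → ℂ} (hw : w ≠ 0)
    {c : ℂ} (h : ∀ i, w (i + 1) + w (i - 1) = c * w i) :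
    ∃ j : ZMod n, c = stdAddChar j + stdAddChar (-j) := by
  have hF : ZMod.dft w ≠ 0 := fun h0 => hw (by simpa using h0)
  obtain ⟨j, hj⟩ := Function.ne_iff.1 hF
  refine ⟨j, mul_right_cancel₀ hj ?_⟩
  simp only [ZMod.dft_apply, smul_eq_mul, Finset.mul_sum, add_mul]
  have e1 : ∑ i, stdAddChar (-(i * j)) * w (i + 1) =
      ∑ i, stdAddChar j * (stdAddChar (-(i * j)) * w i) := by
    rw [← Equiv.sum_comp (Equiv.addRight (1 : ZMod n))
      (fun i => stdAddChar j * (stdAddChar (-(i * j)) * w i))]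
    refine Finset.sum_congr rfl fun i _ => ?_
    rw [← mul_assoc, ← AddChar.map_add_eq_mul]
    simp only [Equiv.coe_addRight]
    congr 2; ring
  have e2 : ∑ i, stdAddChar (-(i * j)) * w (i - 1) =
      ∑ i, stdAddChar (-j) * (stdAddChar (-(i * j)) * w i) := by
    rw [← Equiv.sum_comp (Equiv.subRight (1 : ZMod n))
      (fun i => stdAddChar (-j) * (stdAddChar (-(i * j)) * w i))]
    refine Finset.sum_congr rfl fun i _ => ?_
    rw [← mul_assoc, ← AddChar.map_add_eq_mul]
    simp only [Equiv.subRight_apply]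
    congr 2; ring
  rw [Finset.sum_add_distrib, ← e1, ← e2, ← Finset.sum_add_distrib, Finset.sum_congr rfl]
  intro i _
  rw [← mul_add, h]; ring

lemma exists_cos_of_cycle_eigenvector {m : ℕ} {w : Fin (m + 3) → ℝ} (hw : w ≠ 0)
    {c : ℝ} (h : ∀ i, w (i + 1) + w (i - 1) = c * w i) :
    ∃ j : ℕ, j < m + 3 ∧ c = 2 * Real.cos (2 * Real.pi * j / (m + 3 : ℕ)) := by
  obtain ⟨j, hj⟩ := exists_stdAddChar_of_cycle_eigenvector (n := m + 3)
    (w := fun i => ((w i : ℝ) : ℂ)) (c := (c : ℂ))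
    (fun h0 => hw (funext fun i => Complex.ofReal_eq_zero.1 (congrFun h0 i)))
    (fun i => by exact_mod_cast h i)
  refine ⟨j.val, ZMod.val_lt j, ?_⟩
  have e1 := ZMod.stdAddChar_coe (N := m + 3) (j.val : ℤ)
  have e2 := ZMod.stdAddChar_coe (N := m + 3) (-(j.val : ℤ))
  simp only [Int.cast_neg, Int.cast_natCast, ZMod.natCast_zmod_val] at e1 e2
  have : (c : ℂ) = ((2 * Real.cos (2 * Real.pi * j.val / (m + 3 : ℕ)) : ℝ) : ℂ) := by
    rw [hj, e1, e2, Complex.ofReal_mul, Complex.ofReal_cos, Complex.ofReal_ofNat,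
      Complex.two_cos]
    push_cast
    congr 2 <;> ring
  exact_mod_cast this

lemma exists_cos_of_mem_range_prism_qEig {m : ℕ}
    [DecidableEq (Fin (m + 3) × Fin 2)]
    [DecidableRel ((SimpleGraph.cycleGraph (m + 3)).boxProd (SimpleGraph.pathGraph 2)).Adj]
    {μ : ℝ} (hμ : μ ∈ Set.range (qEig
      ((SimpleGraph.cycleGraph (m + 3)).boxProd (SimpleGraph.pathGraph 2)))) :
    ∃ j : ℕ, j < m + 3 ∧ (μ - 3 = 2 * Real.cos (2 * Real.pi * j / (m + 3 : ℕ)) - 1 ∨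
      μ - 3 = 2 * Real.cos (2 * Real.pi * j / (m + 3 : ℕ)) + 1) := by
  obtain ⟨v, hv, h⟩ := (mem_range_qEig_iff _ _).1 hμ
  have key : ∀ i s, 3 * v (i, s) + (v (i + 1, s) + v (i - 1, s) + v (i, s + 1)) =
      μ * v (i, s) := fun i s => by
    rw [← prism_signlessLaplacian_mulVec, h]; rfl
  have k0 := fun i => key i 0
  have k1 := fun i => key i 1
  simp only [show (0 : Fin 2) + 1 = 1 from rfl, show (1 : Fin 2) + 1 = 0 from rfl] at k0 k1
  by_cases hm : (fun i => v (i, 0) - v (i, 1)) = 0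
  · have hp : (fun i => v (i, 0) + v (i, 1)) ≠ 0 := by
      intro hp
      refine hv (funext fun ⟨i, s⟩ => ?_)
      have a := congrFun hm i
      have b := congrFun hp i
      simp only [Pi.zero_apply] at a b ⊢
      fin_cases s
      · change v (i, 0) = 0; linarith
      · change v (i, 1) = 0; linarith
    obtain ⟨j, hj, e⟩ := exists_cos_of_cycle_eigenvector hp (c := μ - 4)
      (fun i => by linarith [k0 i, k1 i])
    exact ⟨j, hj, Or.inr (by linarith)⟩
  · obtain ⟨j, hj, e⟩ := exists_cos_of_cycle_eigenvector hm (c := μ - 2)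
      (fun i => by linarith [k0 i, k1 i])
    exact ⟨j, hj, Or.inl (by linarith)⟩

lemma cos_fin_add_one_add_cos_fin_sub_one (m j : ℕ) (i : Fin (m + 3)) :
    Real.cos (2 * Real.pi * j / (m + 3 : ℕ) * (i + 1 : Fin (m + 3)).val) +
      Real.cos (2 * Real.pi * j / (m + 3 : ℕ) * (i - 1 : Fin (m + 3)).val) =
    2 * Real.cos (2 * Real.pi * j / (m + 3 : ℕ)) *
      Real.cos (2 * Real.pi * j / (m + 3 : ℕ) * i.val) := by
  set θ := 2 * Real.pi * j / (m + 3 : ℕ) with hθ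
  have hn : ((m + 3 : ℕ) : ℝ) ≠ 0 := by positivity
  have hper : θ * (m + 3 : ℕ) = j * (2 * Real.pi) := by
    rw [hθ]; field_simp
  have succ : ∀ k : Fin (m + 3), Real.cos (θ * (k + 1 : Fin (m + 3)).val) =
      Real.cos (θ * k.val + θ) ∧ Real.sin (θ * (k + 1 : Fin (m + 3)).val) =
      Real.sin (θ * k.val + θ) := by
    intro k
    rcases eq_or_ne k (Fin.last (m + 2)) with rfl | hk
    · have e : θ * (Fin.last (m + 2)).val + θ = j * (2 * Real.pi) := by
        rw [← hper]; simp only [Fin.val_last]; push_cast; ring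
      rw [Fin.last_add_one, e]
      have hsin : Real.sin (j * (2 * Real.pi)) = 0 := by
        simpa using Real.sin_add_nat_mul_two_pi 0 j
      simp [Real.cos_nat_mul_two_pi, hsin]
    · have hlt : k < Fin.last (m + 2) := lt_of_le_of_ne (Fin.le_last k) hk
      rw [Fin.val_add_one_of_lt hlt]
      push_cast
      rw [mul_add, mul_one]
      exact ⟨rfl, rfl⟩
  have h := succ (i - 1)
  rw [sub_add_cancel] at h
  rw [(succ i).1]
  have e : θ * (i - 1 : Fin (m + 3)).val =
    (θ * (i - 1 : Fin (m + 3)).val + θ) - θ := by ring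
  rw [e, Real.cos_sub _ θ, ← h.1, ← h.2, Real.cos_add]
  ring

lemma two_cos_add_two_mem_range_prism_qEig (m j : ℕ)
    [DecidableEq (Fin (m + 3) × Fin 2)]
    [DecidableRel ((SimpleGraph.cycleGraph (m + 3)).boxProd (SimpleGraph.pathGraph 2)).Adj] :
    2 * Real.cos (2 * Real.pi * j / (m + 3 : ℕ)) + 2 ∈ Set.range (qEig
      ((SimpleGraph.cycleGraph (m + 3)).boxProd (SimpleGraph.pathGraph 2))) := by
  rw [mem_range_qEig_iff]
  refine ⟨fun p => (-1) ^ p.2.val * Real.cos (2 * Real.pi * j / (m + 3 : ℕ) * p.1.val),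
    fun h => ?_, funext fun ⟨i, s⟩ => ?_⟩
  · simpa using congrFun h (0, 0)
  · have hc := cos_fin_add_one_add_cos_fin_sub_one m j i
    have hs : (-1 : ℝ) ^ (s + 1).val = -(-1) ^ s.val := by fin_cases s <;> simp
    rw [prism_signlessLaplacian_mulVec]
    simp only [Pi.smul_apply, smul_eq_mul, hs]
    linear_combination (-1) ^ s.val * hc

/-- Fold the angles onto `[0, π]`, turning `x ↦ 2 cos x + 1` into `x ↦ 2 cos x - 1`. -/
lemma exists_fold_angle {n j : ℕ} (hj : j < n) {x : ℝ}
    (hx : x = 2 * Real.cos (2 * Real.pi * j / n) - 1 ∨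
      x = 2 * Real.cos (2 * Real.pi * j / n) + 1) :
    ∃ k : ℕ, k ≤ n ∧ (n % 2 = 0 → k % 2 = 0) ∧ |x| = |2 * Real.cos (Real.pi * k / n) - 1| := by
  have hn : (n : ℝ) ≠ 0 := by norm_cast; omega
  rcases hx with rfl | rfl <;> rcases le_total (2 * j) n with h | h
  · refine ⟨2 * j, h, by omega, ?_⟩
    push_cast
    congr 4; ring
  · refine ⟨2 * n - 2 * j, by omega, by omega, ?_⟩
    rw [Nat.cast_sub (by omega)]
    push_cast
    rw [show Real.pi * (2 * n - 2 * j) / n = 2 * Real.pi - 2 * Real.pi * j / n by field_simp,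
      Real.cos_two_pi_sub]
  · refine ⟨n - 2 * j, by omega, by omega, ?_⟩
    rw [Nat.cast_sub (by omega)]
    push_cast
    rw [show Real.pi * (n - 2 * j) / n = Real.pi - 2 * Real.pi * j / n by field_simp,
      Real.cos_pi_sub, ← abs_neg]
    congr 1; ring
  · refine ⟨2 * j - n, by omega, by omega, ?_⟩
    rw [Nat.cast_sub (by omega)]
    push_cast
    rw [show Real.pi * (2 * j - n) / n = 2 * Real.pi * j / n - Real.pi by field_simp,
      Real.cos_sub_pi, ← abs_neg]
    congr 1; ring

lemma le_abs_two_cos_sub_one {a b t θ : ℝ} (ha : a ≤ Real.pi) (hb : 0 ≤ b)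
    (hta : t ≤ 2 * Real.cos a - 1) (htb : t ≤ 1 - 2 * Real.cos b)
    (h0 : 0 ≤ θ) (hπ : θ ≤ Real.pi) (h : θ ≤ a ∨ b ≤ θ) : t ≤ |2 * Real.cos θ - 1| := by
  rcases h with h | h
  · have := Real.cos_le_cos_of_nonneg_of_le_pi h0 ha h
    exact le_trans (by linarith) (le_abs_self _)
  · have := Real.cos_le_cos_of_nonneg_of_le_pi hb hπ h
    exact le_trans (by linarith) (neg_le_abs _)

lemma cos_add_cos_le_one {δ : ℝ} (h0 : 0 ≤ δ) (h1 : δ ≤ Real.pi / 3) :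
    Real.cos (Real.pi / 3 - δ) + Real.cos (Real.pi / 3 + 2 * δ) ≤ 1 := by
  rw [Real.cos_add_cos]
  have h2 : Real.cos ((Real.pi / 3 - δ + (Real.pi / 3 + 2 * δ)) / 2) ≤ 1 / 2 := by
    rw [← Real.cos_pi_div_three]
    apply Real.cos_le_cos_of_nonneg_of_le_pi <;> linarith [Real.pi_pos]
  have h3 : 0 ≤ Real.cos ((Real.pi / 3 - δ - (Real.pi / 3 + 2 * δ)) / 2) := by
    apply Real.cos_nonneg_of_mem_Icc
    constructor <;> linarith
  have h4 := Real.cos_le_one ((Real.pi / 3 - δ - (Real.pi / 3 + 2 * δ)) / 2)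
  nlinarith

lemma one_le_cos_add_cos {δ : ℝ} (h0 : 0 ≤ δ) (h1 : δ ≤ Real.pi / 6) :
    1 ≤ Real.cos (Real.pi / 3 - 2 * δ) + Real.cos (Real.pi / 3 + δ) := by
  have hπ := Real.pi_pos
  set t := 6 * δ / Real.pi with ht
  have ht0 : 0 ≤ t := by positivity
  have ht1 : t ≤ 1 := by rw [ht, div_le_one hπ]; linarith
  have hδ : δ = t * (Real.pi / 6) := by rw [ht]; field_simp
  have hc := strictConcaveOn_cos_Icc.concaveOn.2
  have m0 : (0 : ℝ) ∈ Set.Icc (-(Real.pi / 2)) (Real.pi / 2) := by constructor <;> linarith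
  have m1 : Real.pi / 3 ∈ Set.Icc (-(Real.pi / 2)) (Real.pi / 2) := by constructor <;> linarith
  have m2 : Real.pi / 2 ∈ Set.Icc (-(Real.pi / 2)) (Real.pi / 2) := by constructor <;> linarith
  have c1 := hc m1 m0 (sub_nonneg.2 ht1) ht0 (by ring)
  have c2 := hc m1 m2 (sub_nonneg.2 ht1) ht0 (by ring)
  simp only [smul_eq_mul, Real.cos_pi_div_three, Real.cos_zero, Real.cos_pi_div_two] at c1 c2
  rw [show (1 - t) * (Real.pi / 3) + t * 0 = Real.pi / 3 - 2 * δ by rw [hδ]; ring] at c1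
  rw [show (1 - t) * (Real.pi / 3) + t * (Real.pi / 2) = Real.pi / 3 + δ by rw [hδ]; ring] at c2
  linarith

lemma prism_inf'_eq {m j : ℕ} {t : ℝ}
    [DecidableEq (Fin (m + 3) × Fin 2)]
    [DecidableRel ((SimpleGraph.cycleGraph (m + 3)).boxProd (SimpleGraph.pathGraph 2)).Adj]
    (hne : (Finset.univ : Finset (Fin (m + 3) × Fin 2)).Nonempty)
    (ht : t = |2 * Real.cos (2 * Real.pi * j / (m + 3 : ℕ)) - 1|)
    (hle : ∀ k : ℕ, k ≤ m + 3 → ((m + 3) % 2 = 0 → k % 2 = 0) →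
      t ≤ |2 * Real.cos (Real.pi * k / (m + 3 : ℕ)) - 1|) :
    Finset.univ.inf' hne (fun p => |qEig
      ((SimpleGraph.cycleGraph (m + 3)).boxProd (SimpleGraph.pathGraph 2)) p - 3|) = t := by
  apply le_antisymm
  · obtain ⟨p, hp⟩ := two_cos_add_two_mem_range_prism_qEig m j
    refine (Finset.inf'_le _ (Finset.mem_univ p)).trans_eq ?_
    rw [ht, hp]
    congr 1; ring
  · refine Finset.le_inf' _ _ fun p _ => ?_
    obtain ⟨i, hi, h⟩ := exists_cos_of_mem_range_prism_qEig (Set.mem_range_self p)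
    obtain ⟨k, hk, hpar, e⟩ := exists_fold_angle hi h
    rw [e]
    exact hle k hk hpar

lemma prism_angle_bounds {n k : ℕ} (hn : 0 < n) (hk : k ≤ n) :
    0 ≤ Real.pi * k / n ∧ Real.pi * k / n ≤ Real.pi := by
  have hπ := Real.pi_pos
  have hn' : (0 : ℝ) < n := by exact_mod_cast hn
  have hk' : (k : ℝ) ≤ n := by exact_mod_cast hk
  exact ⟨by positivity, by rw [div_le_iff₀ hn']; gcongr⟩

/-- The two admissible angles enclosing `π / 3` when the lower one is nearer. -/
lemma le_abs_of_lower_nearest {n q k : ℕ} {d : ℝ} (hn : 0 < n) (hd : 0 ≤ d) (hdn : d ≤ n)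
    (hq : 6 * (q : ℝ) = n - d) (hk : k ≤ n)
    (h : k ≤ 2 * q ∨ (n : ℝ) + 2 * d ≤ 3 * k) :
    0 ≤ 2 * Real.cos (2 * Real.pi * q / n) - 1 ∧
    2 * Real.cos (2 * Real.pi * q / n) - 1 ≤ |2 * Real.cos (Real.pi * k / n) - 1| := by
  have hπ := Real.pi_pos
  have hn' : (0 : ℝ) < n := by exact_mod_cast hn
  set δ := Real.pi * d / (3 * n) with hδ
  have h0 : 0 ≤ δ := by positivity
  have h1 : δ ≤ Real.pi / 3 := by
    rw [hδ, div_le_div_iff₀ (by positivity) (by norm_num)]; nlinarith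
  have hA : 2 * Real.pi * q / n = Real.pi / 3 - δ := by
    rw [hδ]; field_simp; linarith
  have hs := cos_add_cos_le_one h0 h1
  obtain ⟨b0, b1⟩ := prism_angle_bounds hn hk
  have hhalf : 1 / 2 ≤ Real.cos (Real.pi / 3 - δ) := by
    rw [← Real.cos_pi_div_three]
    apply Real.cos_le_cos_of_nonneg_of_le_pi <;> linarith
  rw [hA]
  refine ⟨by linarith, le_abs_two_cos_sub_one (a := Real.pi / 3 - δ) (b := Real.pi / 3 + 2 * δ)
    (by linarith) (by linarith) le_rfl (by linarith) b0 b1 (h.imp (fun h => ?_) fun h => ?_)⟩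
  · rw [← hA, div_le_div_iff_of_pos_right hn']
    have : (k : ℝ) ≤ 2 * q := by exact_mod_cast h
    nlinarith
  · rw [hδ, show Real.pi / 3 + 2 * (Real.pi * d / (3 * n)) = Real.pi * ((n + 2 * d) / 3) / n by
      field_simp, div_le_div_iff_of_pos_right hn']
    exact mul_le_mul_of_nonneg_left (by linarith) hπ.le

/-- The two admissible angles enclosing `π / 3` when the upper one is nearer. -/
lemma le_abs_of_upper_nearest {n q k : ℕ} {d : ℝ} (hn : 0 < n) (hd : 0 ≤ d) (hdn : 2 * d ≤ n)
    (hq : 6 * (q : ℝ) = n + d) (hk : k ≤ n)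
    (h : 3 * (k : ℝ) ≤ n - 2 * d ∨ 2 * q ≤ k) :
    0 ≤ 1 - 2 * Real.cos (2 * Real.pi * q / n) ∧
    1 - 2 * Real.cos (2 * Real.pi * q / n) ≤ |2 * Real.cos (Real.pi * k / n) - 1| := by
  have hπ := Real.pi_pos
  have hn' : (0 : ℝ) < n := by exact_mod_cast hn
  set δ := Real.pi * d / (3 * n) with hδ
  have h0 : 0 ≤ δ := by positivity
  have h1 : δ ≤ Real.pi / 6 := by
    rw [hδ, div_le_div_iff₀ (by positivity) (by norm_num)]; nlinarith
  have hB : 2 * Real.pi * q / n = Real.pi / 3 + δ := by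
    rw [hδ]; field_simp; linarith
  have hs := one_le_cos_add_cos h0 h1
  obtain ⟨b0, b1⟩ := prism_angle_bounds hn hk
  have hhalf : Real.cos (Real.pi / 3 + δ) ≤ 1 / 2 := by
    rw [← Real.cos_pi_div_three]
    apply Real.cos_le_cos_of_nonneg_of_le_pi <;> linarith
  rw [hB]
  refine ⟨by linarith, le_abs_two_cos_sub_one (a := Real.pi / 3 - 2 * δ) (b := Real.pi / 3 + δ)
    (by linarith) (by linarith) (by linarith) le_rfl b0 b1 (h.imp (fun h => ?_) fun h => ?_)⟩
  · rw [hδ, show Real.pi / 3 - 2 * (Real.pi * d / (3 * n)) = Real.pi * ((n - 2 * d) / 3) / n by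
      field_simp, div_le_div_iff_of_pos_right hn']
    exact mul_le_mul_of_nonneg_left (by linarith) hπ.le
  · rw [← hB, div_le_div_iff_of_pos_right hn']
    have : 2 * (q : ℝ) ≤ k := by exact_mod_cast h
    nlinarith

open scoped Classical in
/-- For the `n`-prism `Cₙ □ P₂`: if `n ≡ 1, 2 (mod 6)` then the minimum of `|q - 3|`
over the signless Laplacian spectrum equals `2cos(2π⌊n/6⌋/n) - 1`, and if
`n ≡ 4, 5 (mod 6)` it equals `1 - 2cos(2π⌈n/6⌉/n)`. -/
theorem prism_min_dist (n : ℕ) (hn : 3 ≤ n) :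
    ((n % 6 = 1 ∨ n % 6 = 2) →
      Finset.univ.inf' ⟨((⟨0, by omega⟩ : Fin n), (0 : Fin 2)), Finset.mem_univ _⟩
          (fun p =>
            |qEig ((SimpleGraph.cycleGraph n).boxProd (SimpleGraph.pathGraph 2)) p - 3|)
        = 2 * Real.cos (2 * Real.pi * ((n / 6 : ℕ) : ℝ) / (n : ℝ)) - 1)
    ∧ ((n % 6 = 4 ∨ n % 6 = 5) →
      Finset.univ.inf' ⟨((⟨0, by omega⟩ : Fin n), (0 : Fin 2)), Finset.mem_univ _⟩
          (fun p =>
            |qEig ((SimpleGraph.cycleGraph n).boxProd (SimpleGraph.pathGraph 2)) p - 3|)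
        = 1 - 2 * Real.cos (2 * Real.pi * (((n + 5) / 6 : ℕ) : ℝ) / (n : ℝ))) := by
  obtain ⟨m, rfl⟩ : ∃ m, n = m + 3 := ⟨n - 3, by omega⟩
  constructor
  · intro h
    obtain ⟨d, hd, hq⟩ : ∃ d, (m + 3) % 6 = d ∧ 6 * ((m + 3) / 6) + d = m + 3 :=
      ⟨_, rfl, by omega⟩
    generalize (m + 3) / 6 = q at hq ⊢
    have hq' : 6 * (q : ℝ) = (m + 3 : ℕ) - (d : ℝ) := by rw [← hq]; push_cast; ring
    have key : ∀ k : ℕ, k ≤ m + 3 → ((m + 3) % 2 = 0 → k % 2 = 0) → _ := fun k hk hpar =>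
      le_abs_of_lower_nearest (d := d) (by omega) (by positivity)
        (by norm_cast; omega) hq' hk (by norm_cast; omega)
    exact prism_inf'_eq (j := q) _ (abs_of_nonneg (key 0 (by omega) (by omega)).1).symm
      fun k hk hpar => (key k hk hpar).2
  · intro h
    obtain ⟨d, hd, hq⟩ : ∃ d, 6 - (m + 3) % 6 = d ∧ 6 * ((m + 3 + 5) / 6) = m + 3 + d :=
      ⟨_, rfl, by omega⟩
    generalize (m + 3 + 5) / 6 = q at hq ⊢
    have hq' : 6 * (q : ℝ) = (m + 3 : ℕ) + (d : ℝ) := by exact_mod_cast hq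
    have key : ∀ k : ℕ, k ≤ m + 3 → ((m + 3) % 2 = 0 → k % 2 = 0) → _ := fun k hk hpar =>
      le_abs_of_upper_nearest (d := d) (by omega) (by positivity)
        (by norm_cast; omega) hq' hk (by
          rw [le_sub_iff_add_le]; norm_cast; omega)
    refine prism_inf'_eq (j := q) _ ?_ fun k hk hpar => (key k hk hpar).2
    rw [abs_sub_comm]
    exact (abs_of_nonneg (key 0 (by omega) (by omega)).1).symm
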